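/- arXiv:2102.00568 — 4 statements merged into one kernel-verified Lean document; each statement's English description precedes it below -/
import Mathlib

section
/- Let H be a symmetric positive definite p×p real matrix, e ∈ ℝ^p, A an s×p real matrix with full row rank, b ∈ ℝ^s, H̃ a symmetric p×p real matrix, ẽ ∈ ℝ^p, b̃ ∈ ℝ^s. Define M = (A H⁻¹ Aᵀ)⁻¹, M̃ = A H⁻¹ H̃ H⁻¹ Aᵀ, m̃ = A H⁻¹ ẽ + b̃ − A H⁻¹ H̃ H⁻¹ e, κ* = -M (A H⁻¹ e + b), and k̃ = M (M̃ κ* − m̃). For ε near 0 let κ̃*_ε = -(A (H + ε H̃)⁻¹ Aᵀ)⁻¹ (A (H + ε H̃)⁻¹ (e + ε ẽ) + b + ε b̃) be the Lagrange multiplier of the perturbed quadratic program. Then κ̃*_ε = κ* + ε k̃ + o(ε) as ε → 0. -/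
open Matrix Asymptotics Filter Topology

open scoped Matrix.Norms.Operator in
theorem HasDerivAt.matrix_inv {n : Type*} [Fintype n] [DecidableEq n]
    {F : ℝ → Matrix n n ℝ} {F' : Matrix n n ℝ} {x : ℝ} (hF : HasDerivAt F F' x)
    (hx : IsUnit (F x)) :
    HasDerivAt (fun t => (F t)⁻¹) (-((F x)⁻¹ * F' * (F x)⁻¹)) x := by
  obtain ⟨u, hu⟩ := hx
  have h := hasFDerivAt_ringInverse (𝕜 := ℝ) u
  rw [hu] at h
  have h2 := h.comp_hasDerivAt x hF
  have hinv : (↑u⁻¹ : Matrix n n ℝ) = (F x)⁻¹ := by rw [← hu, Matrix.coe_units_inv]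
  simp [Function.comp_def, ← Matrix.nonsing_inv_eq_ringInverse, hinv] at h2
  exact h2

theorem HasDerivAt.matrix_mulVec {m n : Type*} [Fintype m] [Fintype n]
    {F : ℝ → Matrix m n ℝ} {F' : Matrix m n ℝ} {v : ℝ → n → ℝ} {v' : n → ℝ} {x : ℝ}
    (hF : HasDerivAt F F' x) (hv : HasDerivAt v v' x) :
    HasDerivAt (fun t => F t *ᵥ v t) (F' *ᵥ v x + F x *ᵥ v') x := by
  rw [hasDerivAt_pi]
  intro i
  simp only [Matrix.mulVec, dotProduct, Pi.add_apply, ← Finset.sum_add_distrib]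
  exact HasDerivAt.fun_sum fun j _ =>
    (hasDerivAt_pi.1 (hasDerivAt_pi.1 hF i) j).mul (hasDerivAt_pi.1 hv j)

theorem HasDerivAt.const_matrix_mul_mul_const {k l m n : Type*} [Fintype k] [Fintype l] [Fintype m]
    [Fintype n] (B : Matrix k l ℝ) (C : Matrix m n ℝ)
    {F : ℝ → Matrix l m ℝ} {F' : Matrix l m ℝ} {x : ℝ} (hF : HasDerivAt F F' x) :
    HasDerivAt (fun t => B * F t * C) (B * F' * C) x := by
  refine hasDerivAt_pi.2 fun i => hasDerivAt_pi.2 fun j => ?_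
  simp only [Matrix.mul_apply]
  exact HasDerivAt.fun_sum fun c _ => (HasDerivAt.fun_sum fun d _ =>
    (hasDerivAt_pi.1 (hasDerivAt_pi.1 hF d) c).const_mul (B i d)).mul_const (C c j)

theorem Matrix.PosDef.mul_mul_transpose_of_rank_eq {p s : ℕ} {G : Matrix (Fin p) (Fin p) ℝ}
    (hG : G.PosDef) {A : Matrix (Fin s) (Fin p) ℝ} (hA : A.rank = s) :
    (A * G * Aᵀ).PosDef := by
  have hrow : LinearIndependent ℝ A.row := by
    rw [linearIndependent_iff_card_eq_finrank_span, Set.finrank, ← Matrix.rank_eq_finrank_span_row,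
      hA, Fintype.card_fin]
  have h := hG.mul_mul_conjTranspose_same (Matrix.vecMul_injective_iff.2 hrow)
  rwa [Matrix.conjTranspose_eq_transpose_of_trivial] at h

/-- First-order perturbation of the Lagrange multiplier of the
perturbed equality-constrained quadratic program:
`κ̃*_ε = κ* + ε k̃ + o(ε)` where `k̃ = M (M̃ κ* − m̃)`. -/
theorem stmt4 {p s : ℕ}
    (H Ht : Matrix (Fin p) (Fin p) ℝ) (hH : H.PosDef) (hHt : Ht.IsSymm)
    (e et : Fin p → ℝ)
    (A : Matrix (Fin s) (Fin p) ℝ) (hA : A.rank = s)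
    (b bt : Fin s → ℝ)
    (M : Matrix (Fin s) (Fin s) ℝ) (hM : M = (A * H⁻¹ * Aᵀ)⁻¹)
    (Mt : Matrix (Fin s) (Fin s) ℝ) (hMt : Mt = A * H⁻¹ * Ht * H⁻¹ * Aᵀ)
    (mt : Fin s → ℝ)
    (hmt : mt = A.mulVec (H⁻¹.mulVec et) + bt - A.mulVec (H⁻¹.mulVec (Ht.mulVec (H⁻¹.mulVec e))))
    (κstar : Fin s → ℝ)
    (hκ : κstar = -M.mulVec (A.mulVec (H⁻¹.mulVec e) + b))
    (kt : Fin s → ℝ) (hkt : kt = M.mulVec (Mt.mulVec κstar - mt))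
    (κpert : ℝ → (Fin s → ℝ))
    (hκpert : ∀ ε : ℝ, κpert ε =
      -((A * (H + ε • Ht)⁻¹ * Aᵀ)⁻¹).mulVec
        (A.mulVec ((H + ε • Ht)⁻¹.mulVec (e + ε • et)) + b + ε • bt)) :
    (fun ε : ℝ => κpert ε - κstar - ε • kt) =o[𝓝 0] (fun ε : ℝ => ε) := by
  have hHu : IsUnit (H + (0 : ℝ) • Ht) := by simpa using hH.isUnit
  have hSu : IsUnit (A * (H + (0 : ℝ) • Ht)⁻¹ * Aᵀ) := by
    simpa using (hH.inv.mul_mul_transpose_of_rank_eq hA).isUnit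
  have hP : HasDerivAt (fun ε : ℝ => H + ε • Ht) Ht 0 := by
    refine hasDerivAt_pi.2 fun i => hasDerivAt_pi.2 fun j => ?_
    simpa using ((hasDerivAt_id (0 : ℝ)).mul_const (Ht i j)).const_add (H i j)
  have hAc : HasDerivAt (fun _ : ℝ => A) 0 0 :=
    hasDerivAt_pi.2 fun i => hasDerivAt_pi.2 fun j => hasDerivAt_const (0 : ℝ) (A i j)
  have hG := hP.matrix_inv hHu
  have hS := (hG.const_matrix_mul_mul_const A Aᵀ).matrix_inv hSu
  have he : HasDerivAt (fun ε : ℝ => e + ε • et) et 0 := by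
    simpa using ((hasDerivAt_id (0 : ℝ)).smul_const et).const_add e
  have hb : HasDerivAt (fun ε : ℝ => ε • bt) bt 0 := by
    simpa using (hasDerivAt_id (0 : ℝ)).smul_const bt
  have hv := ((hAc.matrix_mulVec (hG.matrix_mulVec he)).add_const b).add hb
  have hκ' := (hS.matrix_mulVec hv).neg
  have h0 : κpert 0 = κstar := by rw [hκpert, hκ, hM]; simp
  have hd : HasDerivAt κpert kt 0 := by
    rw [funext hκpert]
    refine hκ'.congr_deriv ?_
    subst hκ hkt hmt hMt hM
    simp [Matrix.mulVec_add, Matrix.mulVec_sub, Matrix.mulVec_neg, Matrix.neg_mulVec,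
      Matrix.mul_assoc, Matrix.mulVec_mulVec]
    abel
  simpa [h0] using hasDerivAt_iff_isLittleO.1 hd
end

section
/- Let H be a symmetric positive definite p×p real matrix, e ∈ ℝ^p, A an s×p real matrix with full row rank, b ∈ ℝ^s, H̃ a symmetric p×p real matrix, ẽ ∈ ℝ^p, b̃ ∈ ℝ^s. Let z* be the unique minimizer of g(z) = (1/2) zᵀ H z + eᵀ z subject to A z = b, with Lagrange multiplier κ* = -(A H⁻¹ Aᵀ)⁻¹(A H⁻¹ e + b). Define M = (A H⁻¹ Aᵀ)⁻¹, M̃ = A H⁻¹ H̃ H⁻¹ Aᵀ, m̃ = A H⁻¹ ẽ + b̃ − A H⁻¹ H̃ H⁻¹ e, k̃ = M (M̃ κ* − m̃), and d = -H⁻¹(Aᵀ k̃ + H̃ z* + ẽ). For ε near 0 let z̃*_ε be the unique minimizer of (1/2) zᵀ (H + ε H̃) z + (e + ε ẽ)ᵀ z subject to A z = b + ε b̃. Then z̃*_ε − z* = ε d + o(ε) as ε → 0. -/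
open Matrix Asymptotics Filter Topology

theorem abs_dotProduct_le_card_mul_norm {p : ℕ} (u v : Fin p → ℝ) :
    |u ⬝ᵥ v| ≤ p * ‖u‖ * ‖v‖ := by
  calc |u ⬝ᵥ v| ≤ ∑ i, |u i * v i| := Finset.abs_sum_le_sum_abs _ _
    _ ≤ ∑ _i : Fin p, ‖u‖ * ‖v‖ := by
        refine Finset.sum_le_sum fun i _ => ?_
        rw [abs_mul]
        exact mul_le_mul (norm_le_pi_norm u i) (norm_le_pi_norm v i) (abs_nonneg _) (norm_nonneg _)
    _ = p * ‖u‖ * ‖v‖ := by simp [mul_assoc]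

theorem exists_norm_mulVec_le {p : ℕ} (B : Matrix (Fin p) (Fin p) ℝ) :
    ∃ K : ℝ, 0 ≤ K ∧ ∀ v : Fin p → ℝ, ‖B *ᵥ v‖ ≤ K * ‖v‖ :=
  ⟨‖LinearMap.toContinuousLinearMap B.mulVecLin‖, norm_nonneg _, fun v =>
    (LinearMap.toContinuousLinearMap B.mulVecLin).le_opNorm v⟩

theorem Matrix.PosDef.exists_pos_mul_sq_norm_le {p : ℕ} {H : Matrix (Fin p) (Fin p) ℝ}
    (hH : H.PosDef) : ∃ c : ℝ, 0 < c ∧ ∀ v : Fin p → ℝ, c * ‖v‖ ^ 2 ≤ v ⬝ᵥ H *ᵥ v := by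
  have hcont : Continuous fun v : Fin p → ℝ => v ⬝ᵥ H *ᵥ v := by fun_prop
  have hpos : ∀ v : Fin p → ℝ, v ≠ 0 → 0 < v ⬝ᵥ H *ᵥ v := fun v hv => by
    simpa using hH.dotProduct_mulVec_pos hv
  have hscale : ∀ c : ℝ, (∀ u ∈ Metric.sphere (0 : Fin p → ℝ) 1, c ≤ u ⬝ᵥ H *ᵥ u) →
      ∀ v : Fin p → ℝ, c * ‖v‖ ^ 2 ≤ v ⬝ᵥ H *ᵥ v := by
    intro c hc v
    rcases eq_or_ne v 0 with rfl | hv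
    · simp
    have hn : ‖v‖ ≠ 0 := norm_ne_zero_iff.mpr hv
    have h := hc (‖v‖⁻¹ • v) (by simp [norm_smul, hn])
    rw [mulVec_smul, smul_dotProduct, dotProduct_smul, smul_eq_mul, smul_eq_mul] at h
    calc c * ‖v‖ ^ 2 ≤ (‖v‖⁻¹ * (‖v‖⁻¹ * (v ⬝ᵥ H *ᵥ v))) * ‖v‖ ^ 2 := by gcongr
      _ = v ⬝ᵥ H *ᵥ v := by field_simp
  rcases (Metric.sphere (0 : Fin p → ℝ) 1).eq_empty_or_nonempty with hS | hS
  · exact ⟨1, one_pos, hscale 1 (by simp [hS])⟩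
  · obtain ⟨u, hu, hmin⟩ := (isCompact_sphere (0 : Fin p → ℝ) 1).exists_isMinOn hS hcont.continuousOn
    have hu0 : u ≠ 0 := by
      rintro rfl
      simp at hu
    exact ⟨_, hpos u hu0, hscale _ fun v hv => hmin hv⟩

theorem Matrix.IsSymm.quadratic_add {p : ℕ} {Q : Matrix (Fin p) (Fin p) ℝ} (hQ : Q.IsSymm)
    (q y w : Fin p → ℝ) :
    (1/2) * ((y + w) ⬝ᵥ Q *ᵥ (y + w)) + q ⬝ᵥ (y + w) =
      (1/2) * (y ⬝ᵥ Q *ᵥ y) + q ⬝ᵥ y + w ⬝ᵥ (Q *ᵥ y + q) + (1/2) * (w ⬝ᵥ Q *ᵥ w) := by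
  have hsymm : y ⬝ᵥ Q *ᵥ w = w ⬝ᵥ Q *ᵥ y := by
    rw [dotProduct_mulVec, ← mulVec_transpose, hQ.eq, dotProduct_comm]
  simp only [mulVec_add, dotProduct_add, add_dotProduct, hsymm, dotProduct_comm w q]
  ring

/-- First-order perturbation of the minimizer of the perturbed
equality-constrained quadratic program: `z̃*_ε − z* = ε d + o(ε)` where
`d = -H⁻¹(Aᵀ k̃ + H̃ z* + ẽ)` and `k̃ = M (M̃ κ* − m̃)`. -/
theorem stmt6 {p s : ℕ}
    (H Ht : Matrix (Fin p) (Fin p) ℝ) (hH : H.PosDef) (hHt : Ht.IsSymm)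
    (e et : Fin p → ℝ)
    (A : Matrix (Fin s) (Fin p) ℝ) (hA : A.rank = s)
    (b bt : Fin s → ℝ)
    (M : Matrix (Fin s) (Fin s) ℝ) (hM : M = (A * H⁻¹ * Aᵀ)⁻¹)
    (Mt : Matrix (Fin s) (Fin s) ℝ) (hMt : Mt = A * H⁻¹ * Ht * H⁻¹ * Aᵀ)
    (mt : Fin s → ℝ)
    (hmt : mt = A.mulVec (H⁻¹.mulVec et) + bt - A.mulVec (H⁻¹.mulVec (Ht.mulVec (H⁻¹.mulVec e))))
    (κstar : Fin s → ℝ)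
    (hκ : κstar = -M.mulVec (A.mulVec (H⁻¹.mulVec e) + b))
    (zstar : Fin p → ℝ)
    (hzstar : zstar = -(H⁻¹.mulVec (e + Aᵀ.mulVec κstar)))
    (hzmin : A.mulVec zstar = b ∧
      ∀ z : Fin p → ℝ, A.mulVec z = b → z ≠ zstar →
        (1/2) * (zstar ⬝ᵥ H.mulVec zstar) + e ⬝ᵥ zstar
          < (1/2) * (z ⬝ᵥ H.mulVec z) + e ⬝ᵥ z)
    (kt : Fin s → ℝ) (hkt : kt = M.mulVec (Mt.mulVec κstar - mt))
    (d : Fin p → ℝ)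
    (hd : d = -(H⁻¹.mulVec (Aᵀ.mulVec kt + Ht.mulVec zstar + et)))
    (zpert : ℝ → (Fin p → ℝ))
    (hzpert : ∀ᶠ ε : ℝ in 𝓝 0,
      A.mulVec (zpert ε) = b + ε • bt ∧
      ∀ z : Fin p → ℝ, A.mulVec z = b + ε • bt → z ≠ zpert ε →
        (1/2) * (zpert ε ⬝ᵥ (H + ε • Ht).mulVec (zpert ε)) + (e + ε • et) ⬝ᵥ zpert ε
          < (1/2) * (z ⬝ᵥ (H + ε • Ht).mulVec z) + (e + ε • et) ⬝ᵥ z) :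
    (fun ε : ℝ => zpert ε - zstar - ε • d) =o[𝓝 0] (fun ε : ℝ => ε) := by
  have hHdet : IsUnit H.det := (isUnit_iff_isUnit_det H).mp hH.isUnit
  have hHH : H * H⁻¹ = 1 := mul_nonsing_inv H hHdet
  have hMM : A * H⁻¹ * Aᵀ * M = 1 := by
    rw [hM]
    exact mul_nonsing_inv _
      ((isUnit_iff_isUnit_det _).mp (hH.inv.mul_mul_transpose_of_rank_eq hA).isUnit)
  have hHsymm : H.IsSymm := by
    simpa [IsHermitian, IsSymm, conjTranspose_eq_transpose_of_trivial] using hH.isHermitian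
  have hstat : H *ᵥ zstar + e = -(Aᵀ *ᵥ κstar) := by
    rw [hzstar, mulVec_neg, mulVec_mulVec, hHH, one_mulVec]
    abel
  have hstat' : H *ᵥ d + Ht *ᵥ zstar + et = -(Aᵀ *ᵥ kt) := by
    rw [hd, mulVec_neg, mulVec_mulVec, hHH, one_mulVec]
    abel
  have hAk : A *ᵥ (H⁻¹ *ᵥ (Aᵀ *ᵥ kt)) = Mt *ᵥ κstar - mt := by
    rw [hkt, mulVec_mulVec, mulVec_mulVec, mulVec_mulVec, hMM, one_mulVec]
  have hAz : A *ᵥ (H⁻¹ *ᵥ (Ht *ᵥ zstar)) =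
      -(A *ᵥ (H⁻¹ *ᵥ (Ht *ᵥ (H⁻¹ *ᵥ e)))) - Mt *ᵥ κstar := by
    rw [hzstar, hMt]
    simp only [mulVec_neg, mulVec_add, mulVec_mulVec, Matrix.mul_assoc]
    abel
  have hAd : A *ᵥ d = bt := by
    rw [hd]
    simp only [mulVec_neg, mulVec_add, hAk, hAz, hmt]
    abel
  obtain ⟨c, hc, hcoer⟩ := hH.exists_pos_mul_sq_norm_le
  obtain ⟨K, hK, hbound⟩ := exists_norm_mulVec_le Ht
  have hsmall : ∀ᶠ ε : ℝ in 𝓝 0, |ε| * (p * K) < c / 2 := by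
    have ht : Tendsto (fun ε : ℝ => |ε| * (p * K)) (𝓝 0) (𝓝 (|0| * (p * K))) :=
      Continuous.tendsto (by fun_prop) 0
    exact ht.eventually_lt_const (by simpa using hc)
  have hO : (fun ε : ℝ => zpert ε - zstar - ε • d) =O[𝓝 0] (fun ε : ℝ => ε ^ 2) := by
    refine IsBigO.of_bound (4 * (p * ‖Ht *ᵥ d‖) / c) ?_
    filter_upwards [hzpert, hsmall] with ε ⟨hfeas, hmin⟩ hε
    set w := zpert ε - zstar - ε • d with hw
    have hsum : zpert ε = (zstar + ε • d) + w := by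
      rw [hw]
      abel
    have hAy : A *ᵥ (zstar + ε • d) = b + ε • bt := by
      rw [mulVec_add, mulVec_smul, hzmin.1, hAd]
    have hAw : A *ᵥ w = 0 := by
      rw [hw, sub_sub, mulVec_sub, hfeas, hAy, sub_self]
    have horth : ∀ k : Fin s → ℝ, w ⬝ᵥ Aᵀ *ᵥ k = 0 := fun k => by
      rw [dotProduct_mulVec, vecMul_transpose, hAw, zero_dotProduct]
    have hle : (1/2) * (zpert ε ⬝ᵥ (H + ε • Ht) *ᵥ (zpert ε)) + (e + ε • et) ⬝ᵥ zpert ε ≤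
        (1/2) * ((zstar + ε • d) ⬝ᵥ (H + ε • Ht) *ᵥ (zstar + ε • d)) +
          (e + ε • et) ⬝ᵥ (zstar + ε • d) := by
      rcases eq_or_ne (zstar + ε • d) (zpert ε) with h | h
      · rw [h]
      · exact (hmin _ hAy h).le
    rw [hsum, (hHsymm.add (hHt.smul ε)).quadratic_add] at hle
    have hgrad : (H + ε • Ht) *ᵥ (zstar + ε • d) + (e + ε • et) =
        -(Aᵀ *ᵥ κstar) + ε • -(Aᵀ *ᵥ kt) + ε ^ 2 • (Ht *ᵥ d) := by
      rw [← hstat, ← hstat']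
      simp only [add_mulVec, mulVec_add, mulVec_smul, smul_mulVec]
      module
    have hgradw : w ⬝ᵥ ((H + ε • Ht) *ᵥ (zstar + ε • d) + (e + ε • et)) =
        ε ^ 2 * (w ⬝ᵥ Ht *ᵥ d) := by
      rw [hgrad]
      simp [dotProduct_add, horth]
    have hquad : w ⬝ᵥ (H + ε • Ht) *ᵥ w = w ⬝ᵥ H *ᵥ w + ε * (w ⬝ᵥ Ht *ᵥ w) := by
      simp [add_mulVec, smul_mulVec, dotProduct_add]
    rw [hgradw, hquad] at hle
    have hlin : -(p * ‖w‖ * ‖Ht *ᵥ d‖) ≤ w ⬝ᵥ Ht *ᵥ d :=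
      neg_le_of_abs_le (abs_dotProduct_le_card_mul_norm _ _)
    have hlin' : -(ε ^ 2 * (p * ‖w‖ * ‖Ht *ᵥ d‖)) ≤ ε ^ 2 * (w ⬝ᵥ Ht *ᵥ d) := by
      rw [← mul_neg]
      gcongr
    have hpertw : -(c / 2 * ‖w‖ ^ 2) ≤ ε * (w ⬝ᵥ Ht *ᵥ w) := by
      refine neg_le_of_abs_le ?_
      calc |ε * (w ⬝ᵥ Ht *ᵥ w)| ≤ |ε| * (p * ‖w‖ * (K * ‖w‖)) := by
            rw [abs_mul]
            gcongr
            exact (abs_dotProduct_le_card_mul_norm _ _).trans (by gcongr; exact hbound w)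
        _ = |ε| * (p * K) * ‖w‖ ^ 2 := by ring
        _ ≤ c / 2 * ‖w‖ ^ 2 := by gcongr
    have hsq : ‖w‖ * (c * ‖w‖) ≤ ‖w‖ * (4 * (p * ‖Ht *ᵥ d‖) * ε ^ 2) := by
      linarith [hcoer w]
    rw [Real.norm_of_nonneg (sq_nonneg ε), div_mul_eq_mul_div, le_div_iff₀ hc]
    rcases (norm_nonneg w).eq_or_lt with h0 | h0
    · rw [← h0, zero_mul]
      positivity
    · linarith [le_of_mul_le_mul_left hsq h0]
  exact hO.trans_isLittleO (isLittleO_pow_id one_lt_two)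
end

section
/- Let H be a symmetric positive definite p×p real matrix, A an s×p real matrix with full row rank, e ∈ ℝ^p, b ∈ ℝ^s, and suppose the unique minimizer of (1/2) zᵀ H z + eᵀ z subject to A z = b is z* = 0. Let H̃ be symmetric, ẽ ∈ ℝ^p, b̃ ∈ ℝ^s, and let z̃*_ε be the unique minimizer of (1/2) zᵀ (H + ε H̃) z + (e + ε ẽ)ᵀ z subject to A z = b + ε b̃ (for ε small). Define M = (A H⁻¹ Aᵀ)⁻¹ and d = H⁻¹(Aᵀ M A H⁻¹ − I) ẽ + H⁻¹ Aᵀ M b̃ (i.e. d = B w with B = H⁻¹[Aᵀ M A H⁻¹ − I | Aᵀ M] and w = (ẽ; b̃)). Then z̃*_ε = ε d + o(ε) as ε → 0. -/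
open Matrix Asymptotics Filter Topology

/-- First-order optimality condition for an equality-constrained quadratic program. -/
theorem quadratic_minimizer_gradient_orthogonal {m n : Type*} [Fintype n]
    {Q : Matrix n n ℝ} (hQ : Q.IsSymm) {q : n → ℝ} {A : Matrix m n ℝ} {c : m → ℝ} {x : n → ℝ}
    (hx : A.mulVec x = c)
    (hmin : ∀ z : n → ℝ, A.mulVec z = c → z ≠ x →
      (1/2) * (x ⬝ᵥ Q.mulVec x) + q ⬝ᵥ x < (1/2) * (z ⬝ᵥ Q.mulVec z) + q ⬝ᵥ z)
    {v : n → ℝ} (hv : A.mulVec v = 0) : v ⬝ᵥ Q.mulVec x + q ⬝ᵥ v = 0 := by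
  have hsymm : x ⬝ᵥ Q.mulVec v = v ⬝ᵥ Q.mulVec x := by
    rw [dotProduct_mulVec, ← mulVec_transpose, hQ.eq, dotProduct_comm]
  have key : ∀ t : ℝ,
      0 ≤ (1/2 * (v ⬝ᵥ Q.mulVec v)) * (t * t) + (v ⬝ᵥ Q.mulVec x + q ⬝ᵥ v) * t + 0 := by
    intro t
    have h : (1/2) * (x ⬝ᵥ Q.mulVec x) + q ⬝ᵥ x
        ≤ (1/2) * ((x + t • v) ⬝ᵥ Q.mulVec (x + t • v)) + q ⬝ᵥ (x + t • v) := by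
      by_cases hz : x + t • v = x
      · rw [hz]
      · exact (hmin _ (by simp [mulVec_add, mulVec_smul, hv, hx]) hz).le
    simp only [mulVec_add, mulVec_smul, dotProduct_add, add_dotProduct, dotProduct_smul,
      smul_dotProduct, smul_eq_mul, hsymm] at h
    linarith
  have := discrim_le_zero key
  simp only [discrim, mul_zero, sub_zero] at this
  exact pow_eq_zero_iff two_ne_zero |>.mp (le_antisymm this (sq_nonneg _))

theorem norm_sq_le_dotProduct_self {n : Type*} [Fintype n] (x : n → ℝ) :
    ‖x‖ ^ 2 ≤ x ⬝ᵥ x := by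
  have h0 : 0 ≤ x ⬝ᵥ x := Finset.sum_nonneg fun i _ => mul_self_nonneg (x i)
  refine (Real.le_sqrt (norm_nonneg x) h0).mp ?_
  refine (pi_norm_le_iff_of_nonneg (Real.sqrt_nonneg _)).mpr fun i => Real.abs_le_sqrt ?_
  rw [sq]
  exact Finset.single_le_sum (f := fun j => x j * x j) (fun j _ => mul_self_nonneg _)
    (Finset.mem_univ i)

theorem Matrix.exists_norm_mulVec_le {m n : Type*} [Fintype m] [Fintype n] (B : Matrix m n ℝ) :
    ∃ C : ℝ, 0 < C ∧ ∀ x : n → ℝ, ‖B.mulVec x‖ ≤ C * ‖x‖ :=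
  (LinearMap.toContinuousLinearMap B.mulVecLin).bound

theorem Matrix.exists_abs_dotProduct_mulVec_le {m n : Type*} [Fintype m] [Fintype n]
    (B : Matrix m n ℝ) :
    ∃ C : ℝ, 0 ≤ C ∧ ∀ x y, |x ⬝ᵥ B.mulVec y| ≤ C * ‖x‖ * ‖y‖ := by
  obtain ⟨C, hC, h⟩ := B.exists_norm_mulVec_le
  refine ⟨Fintype.card m * C, by positivity, fun x y => ?_⟩
  calc |x ⬝ᵥ B.mulVec y| ≤ ∑ i, |x i * B.mulVec y i| := Finset.abs_sum_le_sum_abs _ _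
    _ ≤ ∑ _i : m, ‖x‖ * (C * ‖y‖) := by
        refine Finset.sum_le_sum fun i _ => ?_
        rw [abs_mul]
        exact mul_le_mul (norm_le_pi_norm x i) ((norm_le_pi_norm _ i).trans (h y))
          (abs_nonneg _) (norm_nonneg _)
    _ = Fintype.card m * C * ‖x‖ * ‖y‖ := by
        rw [Finset.sum_const, Finset.card_univ, nsmul_eq_mul]; ring

open scoped MatrixOrder Matrix.Norms.L2Operator in
theorem Matrix.PosDef.exists_isUnit_eq_conjTranspose_mul_self {n : Type*} [Fintype n]
    [DecidableEq n] {H : Matrix n n ℝ} (hH : H.PosDef) :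
    ∃ B : Matrix n n ℝ, IsUnit B ∧ H = Bᴴ * B :=
  CStarAlgebra.isStrictlyPositive_iff_eq_star_mul_self.mp hH.isStrictlyPositive

/-- A positive definite real matrix is coercive with respect to the sup norm. -/
theorem Matrix.PosDef.exists_mul_norm_sq_le {n : Type*} [Fintype n] [DecidableEq n]
    {H : Matrix n n ℝ} (hH : H.PosDef) :
    ∃ c : ℝ, 0 < c ∧ ∀ x : n → ℝ, c * ‖x‖ ^ 2 ≤ x ⬝ᵥ H.mulVec x := by
  obtain ⟨B, hB, rfl⟩ := hH.exists_isUnit_eq_conjTranspose_mul_self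
  obtain ⟨C, hC, h⟩ := B⁻¹.exists_norm_mulVec_le
  refine ⟨(C ^ 2)⁻¹, by positivity, fun x => ?_⟩
  have hx : B⁻¹.mulVec (B.mulVec x) = x := by
    rw [mulVec_mulVec, nonsing_inv_mul _ ((isUnit_iff_isUnit_det _).mp hB), one_mulVec]
  have h1 : ‖x‖ ^ 2 ≤ C ^ 2 * (B.mulVec x ⬝ᵥ B.mulVec x) := calc
    ‖x‖ ^ 2 ≤ (C * ‖B.mulVec x‖) ^ 2 := by
        have := h (B.mulVec x)
        rw [hx] at this
        gcongr
    _ = C ^ 2 * ‖B.mulVec x‖ ^ 2 := by ring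
    _ ≤ _ := by gcongr; exact norm_sq_le_dotProduct_self _
  rw [← mulVec_mulVec, dotProduct_mulVec, conjTranspose_eq_transpose_of_trivial,
    vecMul_transpose]
  rwa [inv_mul_le_iff₀ (by positivity)]

theorem Matrix.mulVec_transpose_injective_of_rank_eq {s p : ℕ} {A : Matrix (Fin s) (Fin p) ℝ}
    (hA : A.rank = s) : Function.Injective Aᵀ.mulVec := by
  rw [mulVec_injective_iff, col_transpose,
    linearIndependent_iff_card_eq_finrank_span, Fintype.card_fin,
    Set.finrank, ← rank_eq_finrank_span_row, hA]

theorem Matrix.isUnit_det_schur {s p : ℕ} {H : Matrix (Fin p) (Fin p) ℝ} (hH : H.PosDef)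
    {A : Matrix (Fin s) (Fin p) ℝ} (hA : A.rank = s) : IsUnit (A * H⁻¹ * Aᵀ).det := by
  have := hH.inv.conjTranspose_mul_mul_same (mulVec_transpose_injective_of_rank_eq hA)
  simp only [conjTranspose_eq_transpose_of_trivial, transpose_transpose] at this
  exact (isUnit_iff_isUnit_det _).mp this.isUnit

/-- If the unperturbed minimizer is `z* = 0`, then the perturbed
minimizer satisfies `z̃*_ε = ε d + o(ε)` with
`d = H⁻¹(Aᵀ M A H⁻¹ − I) ẽ + H⁻¹ Aᵀ M b̃`, `M = (A H⁻¹ Aᵀ)⁻¹`. -/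
theorem stmt8 {p s : ℕ}
    (H Ht : Matrix (Fin p) (Fin p) ℝ) (hH : H.PosDef) (hHt : Ht.IsSymm)
    (e et : Fin p → ℝ)
    (A : Matrix (Fin s) (Fin p) ℝ) (hA : A.rank = s)
    (b bt : Fin s → ℝ)
    (hzmin : A.mulVec 0 = b ∧
      ∀ z : Fin p → ℝ, A.mulVec z = b → z ≠ 0 →
        (1/2) * ((0 : Fin p → ℝ) ⬝ᵥ H.mulVec 0) + e ⬝ᵥ (0 : Fin p → ℝ)
          < (1/2) * (z ⬝ᵥ H.mulVec z) + e ⬝ᵥ z)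
    (M : Matrix (Fin s) (Fin s) ℝ) (hM : M = (A * H⁻¹ * Aᵀ)⁻¹)
    (d : Fin p → ℝ)
    (hd : d = (H⁻¹ * (Aᵀ * M * A * H⁻¹ - 1)).mulVec et + (H⁻¹ * Aᵀ * M).mulVec bt)
    (zpert : ℝ → (Fin p → ℝ))
    (hzpert : ∀ᶠ ε : ℝ in 𝓝 0,
      A.mulVec (zpert ε) = b + ε • bt ∧
      ∀ z : Fin p → ℝ, A.mulVec z = b + ε • bt → z ≠ zpert ε →
        (1/2) * (zpert ε ⬝ᵥ (H + ε • Ht).mulVec (zpert ε)) + (e + ε • et) ⬝ᵥ zpert ε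
          < (1/2) * (z ⬝ᵥ (H + ε • Ht).mulVec z) + (e + ε • et) ⬝ᵥ z) :
    (fun ε : ℝ => zpert ε - ε • d) =o[𝓝 0] (fun ε : ℝ => ε) := by
  obtain ⟨hb, hmin⟩ := hzmin
  obtain rfl : b = 0 := by rw [← hb, mulVec_zero]
  have hHs : H.IsSymm := by simpa [IsHermitian, IsSymm] using hH.isHermitian
  have he : ∀ v, A.mulVec v = 0 → e ⬝ᵥ v = 0 := fun v hv => by
    simpa using quadratic_minimizer_gradient_orthogonal hHs hb hmin hv
  have hSM : A * H⁻¹ * Aᵀ * M = 1 := by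
    rw [hM, mul_nonsing_inv _ (isUnit_det_schur hH hA)]
  have hHH : H * H⁻¹ = 1 := mul_nonsing_inv _ ((isUnit_iff_isUnit_det _).mp hH.isUnit)
  have hAd : A.mulVec d = bt := by
    have h1 : A * (H⁻¹ * (Aᵀ * M * A * H⁻¹ - 1)) = 0 := by
      calc _ = (A * H⁻¹ * Aᵀ * M) * (A * H⁻¹) - A * H⁻¹ := by
            simp only [Matrix.mul_sub, Matrix.mul_assoc, Matrix.mul_one]
        _ = 0 := by rw [hSM, Matrix.one_mul, sub_self]
    have h2 : A * (H⁻¹ * Aᵀ * M) = 1 := by simpa only [Matrix.mul_assoc] using hSM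
    rw [hd, mulVec_add, mulVec_mulVec, mulVec_mulVec, h1, h2, zero_mulVec, one_mulVec, zero_add]
  have hHd : H.mulVec d = Aᵀ.mulVec ((M * A * H⁻¹).mulVec et + M.mulVec bt) - et := by
    have h1 : H * (H⁻¹ * (Aᵀ * M * A * H⁻¹ - 1)) = Aᵀ * (M * A * H⁻¹) - 1 := by
      rw [← Matrix.mul_assoc, hHH, Matrix.one_mul]; simp only [Matrix.mul_assoc]
    have h2 : H * (H⁻¹ * Aᵀ * M) = Aᵀ * M := by
      rw [Matrix.mul_assoc H⁻¹, ← Matrix.mul_assoc H, hHH, Matrix.one_mul]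
    rw [hd, mulVec_add, mulVec_mulVec, mulVec_mulVec, h1, h2, sub_mulVec, one_mulVec,
      mulVec_add, mulVec_mulVec, mulVec_mulVec]
    abel
  have hdv : ∀ v, A.mulVec v = 0 → v ⬝ᵥ H.mulVec d = - (et ⬝ᵥ v) := fun v hv => by
    rw [hHd, dotProduct_sub, dotProduct_mulVec, vecMul_transpose, hv, zero_dotProduct,
      zero_sub, dotProduct_comm]
  obtain ⟨c, hc, hcoer⟩ := hH.exists_mul_norm_sq_le
  obtain ⟨C, hC, hbd⟩ := Ht.exists_abs_dotProduct_mulVec_le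
  have hsmall : ∀ᶠ ε : ℝ in 𝓝 0, C * |ε| < c / 2 :=
    (by fun_prop : Continuous fun ε : ℝ => C * |ε|).continuousAt.eventually_lt_const
      (by simpa using hc)
  have hO : (fun ε : ℝ => zpert ε - ε • d) =O[𝓝 0] (fun ε : ℝ => ε ^ 2) := by
    refine IsBigO.of_bound (2 * C * ‖d‖ / c) ?_
    filter_upwards [hzpert, hsmall] with ε ⟨hfeas, hopt⟩ hε
    set r := zpert ε - ε • d with hr
    have hz : zpert ε = r + ε • d := by rw [hr]; abel
    have hAr : A.mulVec r = 0 := by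
      rw [hr, mulVec_sub, mulVec_smul, hfeas, hAd, zero_add, sub_self]
    have hopt' := quadratic_minimizer_gradient_orthogonal
      (hHs.add (hHt.smul ε)) hfeas hopt hAr
    rw [hz] at hopt'
    simp only [add_mulVec, smul_mulVec, mulVec_add, mulVec_smul, dotProduct_add,
      dotProduct_smul, add_dotProduct, smul_dotProduct, smul_eq_mul, he r hAr,
      hdv r hAr] at hopt'
    have h1 := hcoer r
    have h2 : |ε * (r ⬝ᵥ Ht.mulVec r)| ≤ |ε| * (C * ‖r‖ * ‖r‖) := by
      rw [abs_mul]; gcongr; exact hbd r r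
    have h3 : |ε ^ 2 * (r ⬝ᵥ Ht.mulVec d)| ≤ ε ^ 2 * (C * ‖r‖ * ‖d‖) := by
      rw [abs_mul, abs_of_nonneg (sq_nonneg ε)]; gcongr; exact hbd r d
    have h4 : c * ‖r‖ ^ 2 ≤ c / 2 * ‖r‖ ^ 2 + ε ^ 2 * (C * ‖r‖ * ‖d‖) := by
      have h5 : C * |ε| * ‖r‖ ^ 2 ≤ c / 2 * ‖r‖ ^ 2 := by gcongr
      linarith [neg_abs_le (ε * (r ⬝ᵥ Ht.mulVec r)), neg_abs_le (ε ^ 2 * (r ⬝ᵥ Ht.mulVec d))]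
    rw [Real.norm_of_nonneg (sq_nonneg ε), div_mul_eq_mul_div, le_div_iff₀ hc]
    rcases (norm_nonneg r).eq_or_lt with h0 | h0
    · rw [← h0, zero_mul]; positivity
    · refine le_of_mul_le_mul_right ?_ h0
      linarith
  refine hO.trans_isLittleO ?_
  simpa using isLittleO_pow_pow (𝕜 := ℝ) one_lt_two
end

section
/- Let H be a symmetric positive definite p×p real matrix, A an s×p real matrix with full row rank, e ∈ ℝ^p, b ∈ ℝ^s, with unperturbed minimizer z* = 0 and Lagrange multiplier κ* (so e = -Aᵀ κ* and b = 0). Let H̃ be symmetric, ẽ ∈ ℝ^p, b̃ ∈ ℝ^s, M = (A H⁻¹ Aᵀ)⁻¹, M̃ = A H⁻¹ H̃ H⁻¹ Aᵀ, m̃ = A H⁻¹ ẽ + b̃ − A H⁻¹ H̃ H⁻¹ e, and k̃ = M (M̃ κ* − m̃). Then: (i) k̃ = -M (A H⁻¹ ẽ + b̃); and (ii) the perturbed Lagrange multiplier κ̃*_ε = -(A (H + ε H̃)⁻¹ Aᵀ)⁻¹ (A (H + ε H̃)⁻¹ (e + ε ẽ) + b + ε b̃) satisfies κ̃*_ε =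 κ* − ε M (A H⁻¹ ẽ + b̃) + o(ε) as ε → 0. -/
open Matrix Asymptotics Filter Topology

/-- Over a field, a matrix of full row rank acts injectively on row vectors. -/
lemma Matrix.vecMul_injective_of_rank_eq {K : Type*} [Field K] {m n : Type*} [Fintype m]
    [Fintype n] {A : Matrix m n K} (hA : A.rank = Fintype.card m) :
    Function.Injective A.vecMul := by
  rw [Matrix.vecMul_injective_iff, linearIndependent_iff_card_eq_finrank_span, ← hA,
    Matrix.rank_eq_finrank_span_row]
  rfl

/-- Matrix inversion over `ℝ` is continuous at every invertible matrix. -/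
lemma Matrix.continuousAt_inv_of_isUnit {n : Type*} [Fintype n] [DecidableEq n]
    {B : Matrix n n ℝ} (hB : IsUnit B) : ContinuousAt Inv.inv B := by
  refine continuousAt_matrix_inv B ?_
  rw [Ring.inverse_eq_inv']
  exact continuousAt_inv₀ ((Matrix.isUnit_iff_isUnit_det B).1 hB).ne_zero

/-- Substituting `e = -Aᵀ κ` and `b = 0` in the formula for the multiplier of a quadratic program
with inverse Hessian `K`. -/
lemma multiplier_eq_sub {p s : ℕ} {K : Matrix (Fin p) (Fin p) ℝ} {A : Matrix (Fin s) (Fin p) ℝ}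
    (hG : IsUnit (A * K * Aᵀ)) (κ bt : Fin s → ℝ) (et : Fin p → ℝ) (ε : ℝ) :
    -((A * K * Aᵀ)⁻¹ *ᵥ (A *ᵥ (K *ᵥ (-(Aᵀ *ᵥ κ) + ε • et)) + 0 + ε • bt)) =
      κ - ε • ((A * K * Aᵀ)⁻¹ *ᵥ (A *ᵥ (K *ᵥ et) + bt)) := by
  have h : (A * K * Aᵀ)⁻¹ *ᵥ (A *ᵥ (K *ᵥ (Aᵀ *ᵥ κ))) = κ := by
    simp only [mulVec_mulVec, ← Matrix.mul_assoc]
    rw [Matrix.mul_assoc, Matrix.mul_assoc, ← Matrix.mul_assoc A,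
      Matrix.nonsing_inv_mul _ ((Matrix.isUnit_iff_isUnit_det _).1 hG), Matrix.one_mulVec]
  simp only [add_zero, mulVec_add, mulVec_neg, mulVec_smul, smul_add, h]
  abel

/-- With unperturbed minimizer `z* = 0` (so `e = -Aᵀ κ*` and `b = 0`):
(i) `k̃ = -M (A H⁻¹ ẽ + b̃)`, and (ii) the perturbed multiplier satisfies
`κ̃*_ε = κ* − ε M (A H⁻¹ ẽ + b̃) + o(ε)` as `ε → 0`. -/
theorem stmt9 {p s : ℕ}
    (H Ht : Matrix (Fin p) (Fin p) ℝ) (hH : H.PosDef) (hHt : Ht.IsSymm)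
    (e et : Fin p → ℝ)
    (A : Matrix (Fin s) (Fin p) ℝ) (hA : A.rank = s)
    (b bt : Fin s → ℝ)
    (M : Matrix (Fin s) (Fin s) ℝ) (hM : M = (A * H⁻¹ * Aᵀ)⁻¹)
    (Mt : Matrix (Fin s) (Fin s) ℝ) (hMt : Mt = A * H⁻¹ * Ht * H⁻¹ * Aᵀ)
    (mt : Fin s → ℝ)
    (hmt : mt = A.mulVec (H⁻¹.mulVec et) + bt - A.mulVec (H⁻¹.mulVec (Ht.mulVec (H⁻¹.mulVec e))))
    (κstar : Fin s → ℝ)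
    (hκ : κstar = -M.mulVec (A.mulVec (H⁻¹.mulVec e) + b))
    (he : e = -(Aᵀ.mulVec κstar)) (hb : b = 0)
    (kt : Fin s → ℝ) (hkt : kt = M.mulVec (Mt.mulVec κstar - mt))
    (κpert : ℝ → (Fin s → ℝ))
    (hκpert : ∀ ε : ℝ, κpert ε =
      -((A * (H + ε • Ht)⁻¹ * Aᵀ)⁻¹).mulVec
        (A.mulVec ((H + ε • Ht)⁻¹.mulVec (e + ε • et)) + b + ε • bt)) :
    kt = -M.mulVec (A.mulVec (H⁻¹.mulVec et) + bt) ∧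
    (fun ε : ℝ => κpert ε - κstar - ε • (-M.mulVec (A.mulVec (H⁻¹.mulVec et) + bt)))
      =o[𝓝 0] (fun ε : ℝ => ε) := by
  subst he hb hM hMt hmt hkt
  constructor
  · simp only [mulVec_sub, mulVec_add, mulVec_neg, mulVec_mulVec, Matrix.mul_assoc]
    abel
  have hGpos : (A * H⁻¹ * Aᵀ).PosDef := by
    simpa using hH.inv.mul_mul_conjTranspose_same
      (Matrix.vecMul_injective_of_rank_eq (A := A) (by simpa using hA))
  let K : ℝ → Matrix (Fin p) (Fin p) ℝ := fun ε => (H + ε • Ht)⁻¹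
  let G : ℝ → Matrix (Fin s) (Fin s) ℝ := fun ε => A * K ε * Aᵀ
  let F : ℝ → Fin s → ℝ := fun ε => (G ε)⁻¹ *ᵥ (A *ᵥ (K ε *ᵥ et) + bt)
  have hK0 : K 0 = H⁻¹ := by simp [K]
  have hG0 : IsUnit (G 0) := by simpa only [G, hK0] using hGpos.isUnit
  have hK : ContinuousAt K 0 :=
    ContinuousAt.comp (g := Inv.inv) (f := fun ε : ℝ => H + ε • Ht)
      (Matrix.continuousAt_inv_of_isUnit (by simpa using hH.isUnit)) (by fun_prop)
  have hG : ContinuousAt G 0 :=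
    ContinuousAt.comp (g := fun X : Matrix (Fin p) (Fin p) ℝ => A * X * Aᵀ) (f := K)
      (by fun_prop) hK
  have hGinv : ContinuousAt (fun ε => (G ε)⁻¹) 0 :=
    ContinuousAt.comp (g := Inv.inv) (f := G) (Matrix.continuousAt_inv_of_isUnit hG0) hG
  have hF : ContinuousAt F 0 :=
    ContinuousAt.comp
      (g := fun X : Matrix (Fin s) (Fin s) ℝ × Matrix (Fin p) (Fin p) ℝ =>
        X.1 *ᵥ (A *ᵥ (X.2 *ᵥ et) + bt))
      (f := fun ε => ((G ε)⁻¹, K ε))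
      (by fun_prop) (hGinv.prodMk hK)
  have hunit : ∀ᶠ ε in 𝓝 (0 : ℝ), IsUnit (G ε) := by
    have hdet : ContinuousAt (fun ε => (G ε).det) 0 :=
      (continuous_id.matrix_det).continuousAt.comp hG
    filter_upwards [hdet.eventually_ne ((Matrix.isUnit_iff_isUnit_det _).1 hG0).ne_zero]
      with ε hε
    exact (Matrix.isUnit_iff_isUnit_det _).2 hε.isUnit
  have hlim : Tendsto (fun ε => F 0 - F ε) (𝓝 0) (𝓝 0) := by
    simpa using (tendsto_const_nhds (x := F 0)).sub hF.tendsto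
  have hsmall : (fun ε : ℝ => ε • (F 0 - F ε)) =o[𝓝 0] (fun ε : ℝ => ε) := by
    simpa using (isBigO_refl (fun ε : ℝ => ε) (𝓝 0)).smul_isLittleO
      ((isLittleO_one_iff ℝ).2 hlim)
  refine hsmall.congr' ?_ EventuallyEq.rfl
  filter_upwards [hunit] with ε hε
  have hpert : κpert ε = κstar - ε • F ε :=
    (hκpert ε).trans (multiplier_eq_sub hε κstar bt et ε)
  have hF0 : F 0 = (A * H⁻¹ * Aᵀ)⁻¹ *ᵥ (A *ᵥ (H⁻¹ *ᵥ et) + bt) := by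
    simp only [F, G, hK0]
  rw [hpert, ← hF0, smul_sub, smul_neg]
  abel
end
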